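/- arXiv:2211.06984 — 3 statements merged into one kernel-verified Lean document; each statement's English description precedes it below -/
import Mathlib

section
/- Let m, n be positive natural numbers and let ψ : Fin m × Fin n → ℂ be a unit vector (a bipartite pure state). Then the von Neumann entropies of the two reduced density matrices coincide: S(ρ_A) = S(ρ_B). -/
open scoped ComplexOrder
noncomputable section
open scoped Classical

/-- The (real) eigenvalues of a matrix (junk value `0` if not Hermitian). -/
def eigs {n : Type*} [Fintype n] [DecidableEq n] (A : Matrix n n ℂ) : n → ℝ :=
  if h : A.IsHermitian then h.eigenvalues else 0

/-- The von Neumann entropy `S(ρ) = ∑ k, -μ_k·log₂ μ_k` of a (Hermitian PSD) matrix,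
where the `μ_k` are its eigenvalues; the convention `0·log₂ 0 = 0` is automatic since
`Real.logb 2 0 = 0`. -/
def vnEntropy {n : Type*} [Fintype n] [DecidableEq n] (ρ : Matrix n n ℂ) : ℝ :=
  ∑ k, -(eigs ρ k * Real.logb 2 (eigs ρ k))

/-- Reduced density matrix `ρ_A` of a bipartite pure state. -/
def redA {m n : ℕ} (ψ : Fin m × Fin n → ℂ) : Matrix (Fin m) (Fin m) ℂ :=
  Matrix.of fun i i' => ∑ j : Fin n, ψ (i, j) * star (ψ (i', j))

/-- Reduced density matrix `ρ_B` of a bipartite pure state. -/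
def redB {m n : ℕ} (ψ : Fin m × Fin n → ℂ) : Matrix (Fin n) (Fin n) ℂ :=
  Matrix.of fun j j' => ∑ i : Fin m, ψ (i, j) * star (ψ (i, j'))

/-- The entropy of a Hermitian matrix as a sum over the roots of its characteristic polynomial. -/
theorem vnEntropy_eq_sum_roots_charpoly {n : Type*} [Fintype n] [DecidableEq n]
    {A : Matrix n n ℂ} (hA : A.IsHermitian) :
    vnEntropy A = (A.charpoly.roots.map fun z => -(z.re * Real.logb 2 z.re)).sum := by
  rw [hA.roots_charpoly_eq_eigenvalues, Multiset.map_map]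
  simp [vnEntropy, eigs, hA]

/-- The nonzero roots of the characteristic polynomials of `A * B` and `B * A` agree, so any sum
over the roots of a function vanishing at `0` is the same for both. -/
theorem sum_map_roots_charpoly_mul_comm {m n R M : Type*} [Fintype m] [Fintype n]
    [DecidableEq m] [DecidableEq n] [CommRing R] [IsDomain R] [AddCommMonoid M]
    (A : Matrix m n R) (B : Matrix n m R) {f : R → M} (hf : f 0 = 0) :
    ((A * B).charpoly.roots.map f).sum = ((B * A).charpoly.roots.map f).sum := by
  have sum_roots_X_pow_mul (k : ℕ) {p : Polynomial R} (hp : p.Monic) :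
      ((Polynomial.X ^ k * p).roots.map f).sum = (p.roots.map f).sum := by
    rw [Polynomial.roots_mul ((Polynomial.monic_X_pow k).mul hp).ne_zero]
    simp [Multiset.map_nsmul, Multiset.sum_nsmul, hf]
  rw [← sum_roots_X_pow_mul (Fintype.card n) (Matrix.charpoly_monic _),
    Matrix.charpoly_mul_comm', sum_roots_X_pow_mul _ (Matrix.charpoly_monic _)]

theorem redA_eq_mul_conjTranspose {m n : ℕ} (ψ : Fin m × Fin n → ℂ) :
    redA ψ = Matrix.of (Function.curry ψ) * (Matrix.of (Function.curry ψ)).conjTranspose := by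
  ext i i'
  simp [redA, Matrix.mul_apply]

theorem redB_eq_transpose_conjTranspose_mul {m n : ℕ} (ψ : Fin m × Fin n → ℂ) :
    redB ψ =
      ((Matrix.of (Function.curry ψ)).conjTranspose * Matrix.of (Function.curry ψ)).transpose := by
  ext j j'
  simp [redB, Matrix.mul_apply, mul_comm]

/-- For a bipartite pure state, the von Neumann entropies of the two reduced
density matrices coincide: `S(ρ_A) = S(ρ_B)`. -/
theorem vnEntropy_redA_eq_redB (m n : ℕ) (hm : 0 < m) (hn : 0 < n)
    (ψ : Fin m × Fin n → ℂ) (hψ : ∑ x, ‖ψ x‖ ^ 2 = 1) :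
    vnEntropy (redA ψ) = vnEntropy (redB ψ) := by
  have hA : (redA ψ).IsHermitian := by
    rw [redA_eq_mul_conjTranspose]
    exact Matrix.isHermitian_mul_conjTranspose_self _
  have hB : (redB ψ).IsHermitian := by
    rw [redB_eq_transpose_conjTranspose_mul]
    exact (Matrix.isHermitian_conjTranspose_mul_self _).transpose
  rw [vnEntropy_eq_sum_roots_charpoly hA, vnEntropy_eq_sum_roots_charpoly hB,
    redA_eq_mul_conjTranspose, redB_eq_transpose_conjTranspose_mul, Matrix.charpoly_transpose]
  exact sum_map_roots_charpoly_mul_comm _ _ (by simp)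

end
end

section
/- Let K ⊆ ℝ × ℝ be a compact set contained in the quadrant [0, ∞) × [0, ∞), and let f : ℝ × ℝ → ℝ be continuous on K with f(x, y) > max(x, y) for all (x, y) ∈ K. Then there exists a single α > 0 such that (x^α + y^α)^{1/α} ≤ f(x, y) for all (x, y) ∈ K. -/
/-- If `K` is a compact subset of the nonnegative quadrant and `f` is continuous on `K`
with `f (x, y) > max x y` on `K`, then there is a single `α > 0` such that
`(x^α + y^α)^(1/α) ≤ f (x, y)` for all `(x, y) ∈ K`. -/
theorem exists_rpow_mean_le_of_continuousOn (K : Set (ℝ × ℝ)) (hK : IsCompact K)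
    (hKpos : K ⊆ Set.Ici 0 ×ˢ Set.Ici 0)
    (f : ℝ × ℝ → ℝ) (hf : ContinuousOn f K)
    (hgt : ∀ p ∈ K, max p.1 p.2 < f p) :
    ∃ α : ℝ, 0 < α ∧ ∀ p ∈ K, (p.1 ^ α + p.2 ^ α) ^ (1 / α) ≤ f p := by
  rcases K.eq_empty_or_nonempty with rfl | hne
  · exact ⟨1, one_pos, by simp⟩
  have hfpos : ∀ p ∈ K, 0 < f p := fun p hp =>
    ((hKpos hp).1.trans (le_max_left _ _)).trans_lt (hgt p hp)
  obtain ⟨q, hq, hmax⟩ := hK.exists_isMaxOn (f := fun p => max p.1 p.2 / f p) hne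
    (ContinuousOn.div (by fun_prop) hf fun p hp => (hfpos p hp).ne')
  set c := max q.1 q.2 / f q
  have hc0 : 0 ≤ c := div_nonneg ((hKpos hq).1.trans (le_max_left _ _)) (hfpos q hq).le
  have hc1 : c < 1 := (div_lt_one (hfpos q hq)).2 (hgt q hq)
  obtain ⟨n, hn⟩ := exists_pow_lt_of_lt_one (show (0 : ℝ) < 1 / 2 by norm_num) hc1
  have hn0 : n ≠ 0 := by
    rintro rfl
    norm_num at hn
  refine ⟨n, by positivity, fun p hp => ?_⟩
  have hx : 0 ≤ p.1 := (hKpos hp).1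
  have hy : 0 ≤ p.2 := (hKpos hp).2
  have hfp := hfpos p hp
  have hle : max p.1 p.2 ≤ c * f p := (div_le_iff₀ hfp).1 (hmax hp)
  have hpow : ∀ t, 0 ≤ t → t ≤ c * f p → t ^ n ≤ 1 / 2 * f p ^ n := fun t ht htc =>
    calc t ^ n ≤ (c * f p) ^ n := pow_le_pow_left₀ ht htc n
      _ = c ^ n * f p ^ n := mul_pow _ _ _
      _ ≤ 1 / 2 * f p ^ n := by gcongr
  have hsum : p.1 ^ n + p.2 ^ n ≤ f p ^ n := by
    linarith [hpow _ hx ((le_max_left _ _).trans hle), hpow _ hy ((le_max_right _ _).trans hle)]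
  rw [Real.rpow_natCast, Real.rpow_natCast, one_div]
  calc (p.1 ^ n + p.2 ^ n) ^ (n : ℝ)⁻¹ ≤ (f p ^ n) ^ (n : ℝ)⁻¹ := by gcongr
    _ = f p := Real.pow_rpow_inv_natCast hfp.le hn0
end

section
/- Define E : ℝ → ℝ by E(C) = h((1 + √(1 − C²))/2), where h(t) = −t·log₂ t − (1−t)·log₂(1−t) is the binary entropy (with the convention 0·log₂ 0 = 0). Then E is strictly monotonically increasing on the interval [0, 1], E(0) = 0, and E(1) = 1. (This is the Wootters formula expressing the entanglement of formation of a two-qubit state as a function of its concurrence C, showing it is a monotonically increasing function of the squared concurrence that vanishes for separable states and equals one for maximally entangled states.) -/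
noncomputable section

/-- Binary entropy `h(t) = -t·log₂ t - (1-t)·log₂(1-t)`; the convention
`0·log₂ 0 = 0` is automatic since `Real.logb 2 0 = 0`. -/
def binEntropy (t : ℝ) : ℝ :=
  -(t * Real.logb 2 t) - (1 - t) * Real.logb 2 (1 - t)

/-- The Wootters entanglement-of-formation function of the concurrence:
`E(C) = h((1 + √(1 - C²))/2)`. -/
def wootters (C : ℝ) : ℝ :=
  binEntropy ((1 + Real.sqrt (1 - C ^ 2)) / 2)

theorem binEntropy_eq_div_log_two (t : ℝ) : binEntropy t = Real.binEntropy t / Real.log 2 := by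
  simp only [binEntropy, Real.binEntropy, Real.logb, Real.log_inv]
  ring

theorem binEntropy_strictAntiOn : StrictAntiOn binEntropy (Set.Icc 2⁻¹ 1) := by
  intro x hx y hy hxy
  rw [binEntropy_eq_div_log_two, binEntropy_eq_div_log_two]
  exact div_lt_div_of_pos_right (Real.binEntropy_strictAntiOn hx hy hxy)
    (Real.log_pos one_lt_two)

theorem strictAntiOn_one_add_sqrt_one_sub_sq_div_two :
    StrictAntiOn (fun C : ℝ => (1 + Real.sqrt (1 - C ^ 2)) / 2) (Set.Icc 0 1) := by
  intro x hx y hy hxy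
  have hsqrt : Real.sqrt (1 - y ^ 2) < Real.sqrt (1 - x ^ 2) :=
    Real.sqrt_lt_sqrt (by nlinarith [hy.1, hy.2]) (by nlinarith [hx.1])
  dsimp only
  linarith

theorem one_add_sqrt_one_sub_sq_div_two_mem_Icc (C : ℝ) :
    (1 + Real.sqrt (1 - C ^ 2)) / 2 ∈ Set.Icc (2⁻¹ : ℝ) 1 := by
  have hnonneg := Real.sqrt_nonneg (1 - C ^ 2)
  have hle : Real.sqrt (1 - C ^ 2) ≤ 1 := Real.sqrt_le_one.mpr (by nlinarith [sq_nonneg C])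
  constructor <;> linarith

/-- The Wootters function `E(C) = h((1 + √(1 - C²))/2)` is strictly monotonically
increasing on `[0, 1]`, with `E(0) = 0` and `E(1) = 1`. -/
theorem wootters_strictMonoOn_map_zero_one :
    StrictMonoOn wootters (Set.Icc 0 1) ∧ wootters 0 = 0 ∧ wootters 1 = 1 := by
  refine ⟨binEntropy_strictAntiOn.comp strictAntiOn_one_add_sqrt_one_sub_sq_div_two
    fun C _ => one_add_sqrt_one_sub_sq_div_two_mem_Icc C, ?_, ?_⟩
  · norm_num [wootters, binEntropy_eq_div_log_two]
  · have hhalf : ((1 + Real.sqrt (1 - 1 ^ 2)) / 2 : ℝ) = 2⁻¹ := by norm_num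
    rw [wootters, hhalf, binEntropy_eq_div_log_two, Real.binEntropy_two_inv,
      div_self (Real.log_pos one_lt_two).ne']

end
end
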